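/- Magic power is subadditive under multiplication and tensorization: for unitaries U, V on (ℂ^d)^{⊗n}, 𝓜[UV] ≤ 𝓜[U] + 𝓜[V]; and for a unitary U on (ℂ^d)^{⊗n₁} and a unitary V on (ℂ^d)^{⊗n₂}, 𝓜[U ⊗ V] ≤ 𝓜[U] + 𝓜[V], where each 𝓜 is computed on the corresponding space. -/

import Mathlib

open Matrix Complex BigOperators
open scoped ComplexOrder
noncomputable section

namespace QC

/-- Operators on the `n`-qudit space `(ℂ^d)^{⊗n}`, as matrices indexed by
computational basis labels `Fin n → Fin d`. -/
abbrev QOp (d n : ℕ) := Matrix (Fin n → Fin d) (Fin n → Fin d) ℂ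

/-- The qudit shift operator `X`, with `X|j⟩ = |j+1 mod d⟩`. -/
def shiftX (d : ℕ) : Matrix (Fin d) (Fin d) ℂ :=
  fun i j => if (i : ℕ) = ((j : ℕ) + 1) % d then 1 else 0

/-- The qudit clock operator `Z`, with `Z|j⟩ = e^{2πij/d}|j⟩`. -/
def clockZ (d : ℕ) : Matrix (Fin d) (Fin d) ℂ :=
  Matrix.diagonal (fun j => Complex.exp (2 * Real.pi * Complex.I * (j : ℕ) / d))

/-- The single-qudit Pauli operator `P_a = X^s Z^t` for `a = (s,t) ∈ ℤ_d × ℤ_d`. -/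
def pauli1 (d : ℕ) (a : ZMod d × ZMod d) : Matrix (Fin d) (Fin d) ℂ :=
  shiftX d ^ a.1.val * clockZ d ^ a.2.val

/-- The `n`-qudit Pauli operator `P_ā = P_{a_1} ⊗ ⋯ ⊗ P_{a_n}`. -/
def pauliN (d n : ℕ) (a : Fin n → ZMod d × ZMod d) : QOp d n :=
  fun x y => ∏ i, pauli1 d (a i) (x i) (y i)

/-- The weight `|ā|`: the number of indices `i` with `a_i ≠ (0,0)`. -/
def weight (d n : ℕ) (a : Fin n → ZMod d × ZMod d) : ℕ :=
  (Finset.univ.filter (fun i => a i ≠ 0)).card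

/-- `P_O[ā] = |Tr(O P_ā)|² / d^{2n}`. -/
def pdist (d n : ℕ) (O : QOp d n) (a : Fin n → ZMod d × ZMod d) : ℝ :=
  ‖(O * pauliN d n a).trace‖ ^ 2 / (d : ℝ) ^ (2 * n)

/-- The normalized 2-norm `‖O‖₂ = (Tr(O†O)/d^n)^{1/2}`. -/
def l2norm (d n : ℕ) (O : QOp d n) : ℝ :=
  Real.sqrt (((Oᴴ * O).trace).re / (d : ℝ) ^ n)

/-- The total influence `I[O] = Σ_ā |ā|·P_O[ā]`. -/
def influence (d n : ℕ) [NeZero d] (O : QOp d n) : ℝ :=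
  ∑ a : Fin n → ZMod d × ZMod d, (weight d n a : ℝ) * pdist d n O a

/-- The local influence `I_j[O] = Σ_{ā : a_j ≠ 0} P_O[ā]`. -/
def localInfluence (d n : ℕ) [NeZero d] (j : Fin n) (O : QOp d n) : ℝ :=
  ∑ a ∈ Finset.univ.filter (fun a : Fin n → ZMod d × ZMod d => a j ≠ 0), pdist d n O a

/-- The quantum Fourier entropy `H[O] = -Σ_ā P_O[ā] log₂ P_O[ā]` (with `0·log 0 = 0`). -/
def qEntropy (d n : ℕ) [NeZero d] (O : QOp d n) : ℝ :=
  -∑ a : Fin n → ZMod d × ZMod d, pdist d n O a * Real.logb 2 (pdist d n O a)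

/-- The binary entropy `h(x) = -x log₂ x - (1-x) log₂ (1-x)`. -/
def binEntropy (x : ℝ) : ℝ :=
  -(x * Real.logb 2 x) - (1 - x) * Real.logb 2 (1 - x)

/-- Circuit sensitivity `CiS[U] = sup { |I[UOU†] - I[O]| : ‖O‖₂ = 1 }`. -/
def CiS (d n : ℕ) [NeZero d] (U : QOp d n) : ℝ :=
  sSup {x : ℝ | ∃ O : QOp d n, l2norm d n O = 1 ∧
    x = |influence d n (U * O * Uᴴ) - influence d n O|}

/-- Magic power `𝓜[U] = sup { |H[UOU†] - H[O]| : ‖O‖₂ = 1 }`. -/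
def magicPower (d n : ℕ) [NeZero d] (U : QOp d n) : ℝ :=
  sSup {x : ℝ | ∃ O : QOp d n, l2norm d n O = 1 ∧
    x = |qEntropy d n (U * O * Uᴴ) - qEntropy d n O|}

/-- Magic entropy `M[U] = max { H[U P_ā U†] : |ā| = 1 }`. -/
def magicEntropy (d n : ℕ) [NeZero d] (U : QOp d n) : ℝ :=
  sSup {x : ℝ | ∃ a : Fin n → ZMod d × ZMod d, weight d n a = 1 ∧
    x = qEntropy d n (U * pauliN d n a * Uᴴ)}

/-- The operator norm `‖A‖∞` (the L2 → L2 operator norm). -/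
def opNorm (d n : ℕ) (A : QOp d n) : ℝ :=
  ‖Matrix.toEuclideanCLM (𝕜 := ℂ) (n := Fin n → Fin d) A‖

/-- The influence rate `R_I(H,O)`. -/
def influenceRate (d n : ℕ) [NeZero d] (H O : QOp d n) : ℂ :=
  (Complex.I / (d : ℂ) ^ (2 * n)) * ∑ a : Fin n → ZMod d × ZMod d, (weight d n a : ℂ) *
    (((O * H - H * O) * pauliN d n a).trace * (O * (pauliN d n a)ᴴ).trace +
     ((O * H - H * O) * (pauliN d n a)ᴴ).trace * (O * pauliN d n a).trace)

/-- The magic rate `R_M(H,O)`. -/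
def magicRate (d n : ℕ) [NeZero d] (H O : QOp d n) : ℂ :=
  (Complex.I / (d : ℂ) ^ (2 * n)) * ∑ a : Fin n → ZMod d × ZMod d,
    (((O * H - H * O) * pauliN d n a).trace * (O * (pauliN d n a)ᴴ).trace +
     ((O * H - H * O) * (pauliN d n a)ᴴ).trace * (O * pauliN d n a).trace) *
    (Real.logb 2 (pdist d n O a) : ℂ)

/-- Extend an operator on the first `k` qudits by the identity: `H₀ ⊗ I`. -/
def extendOp (d k n : ℕ) (h : k ≤ n) (H0 : QOp d k) : QOp d n :=
  fun x y => if ∀ i : Fin n, k ≤ (i : ℕ) → x i = y i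
    then H0 (fun i => x (Fin.castLE h i)) (fun i => y (Fin.castLE h i)) else 0

/-- The tensor product `A ⊗ B` of an `n₁`-qudit and an `n₂`-qudit operator. -/
def tensorOp (d n₁ n₂ : ℕ) (A : QOp d n₁) (B : QOp d n₂) : QOp d (n₁ + n₂) :=
  fun x y => A (fun i => x (Fin.castAdd n₂ i)) (fun i => y (Fin.castAdd n₂ i)) *
             B (fun i => x (Fin.natAdd n₁ i)) (fun i => y (Fin.natAdd n₁ i))

/-- Embed a single-qudit operator `W` at position `j` (identity elsewhere). -/
def embedAt (d n : ℕ) (j : Fin n) (W : Matrix (Fin d) (Fin d) ℂ) : QOp d n :=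
  fun x y => if ∀ i, i ≠ j → x i = y i then W (x j) (y j) else 0

/-- The swap unitary exchanging qudits `i` and `j`. -/
def swapOp (d n : ℕ) (i j : Fin n) : QOp d n :=
  fun x y => if x = y ∘ Equiv.swap i j then 1 else 0

/-- The qubit Pauli X matrix. -/
def pauliX : Matrix (Fin 2) (Fin 2) ℂ := !![0, 1; 1, 0]

/-- The qubit Pauli Y matrix. -/
def pauliY : Matrix (Fin 2) (Fin 2) ℂ := !![0, -Complex.I; Complex.I, 0]

/-- The qubit Pauli Z matrix. -/
def pauliZ : Matrix (Fin 2) (Fin 2) ℂ := !![1, 0; 0, -1]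

/-- The ordered product `γ^S = ∏_{i∈S} γ_i` (factors in increasing index order). -/
def gammaProd (n : ℕ) (γ : Fin (2 * n) → QOp 2 n) (S : Finset (Fin (2 * n))) : QOp 2 n :=
  ((S.sort (· ≤ ·)).map γ).prod

/-- `P^G_O[S] = |Tr((γ^S)† O)|² / 2^{2n}`. -/
def pdistG (n : ℕ) (γ : Fin (2 * n) → QOp 2 n) (O : QOp 2 n) (S : Finset (Fin (2 * n))) : ℝ :=
  ‖((gammaProd n γ S)ᴴ * O).trace‖ ^ 2 / (2 : ℝ) ^ (2 * n)

/-- The Gaussian influence `I^G[O] = Σ_S |S|·P^G_O[S]`. -/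
def influenceG (n : ℕ) (γ : Fin (2 * n) → QOp 2 n) (O : QOp 2 n) : ℝ :=
  ∑ S : Finset (Fin (2 * n)), (S.card : ℝ) * pdistG n γ O S

/-- The Gaussian Fourier entropy `H^G[O] = -Σ_S P^G_O[S] log₂ P^G_O[S]`. -/
def entropyG (n : ℕ) (γ : Fin (2 * n) → QOp 2 n) (O : QOp 2 n) : ℝ :=
  -∑ S : Finset (Fin (2 * n)), pdistG n γ O S * Real.logb 2 (pdistG n γ O S)

/-- Gaussian circuit sensitivity `CiS^G[U] = sup { |I^G[UOU†] - I^G[O]| : ‖O‖₂ = 1 }`. -/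
def CiSG (n : ℕ) (γ : Fin (2 * n) → QOp 2 n) (U : QOp 2 n) : ℝ :=
  sSup {x : ℝ | ∃ O : QOp 2 n, l2norm 2 n O = 1 ∧
    x = |influenceG n γ (U * O * Uᴴ) - influenceG n γ O|}

/-- Fourier coefficient `f̂(S)` of a Boolean function `f : {-1,1}^n → ℝ`, with
the domain encoded as `Fin n → Bool` (`true ↦ -1`, `false ↦ 1`). -/
def fourierCoeff (n : ℕ) (f : (Fin n → Bool) → ℝ) (S : Finset (Fin n)) : ℝ :=
  (∑ x : Fin n → Bool, f x * ∏ i ∈ S, (if x i then -1 else 1)) / 2 ^ n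

/-- Fourier entropy of a Boolean function. -/
def boolEntropy (n : ℕ) (f : (Fin n → Bool) → ℝ) : ℝ :=
  -∑ S : Finset (Fin n), (fourierCoeff n f S) ^ 2 * Real.logb 2 ((fourierCoeff n f S) ^ 2)

/-- Total influence of a Boolean function. -/
def boolInfluence (n : ℕ) (f : (Fin n → Bool) → ℝ) : ℝ :=
  ∑ S : Finset (Fin n), (S.card : ℝ) * (fourierCoeff n f S) ^ 2

/-- The completely dephasing channel `Δ`. -/
def dephase (d n : ℕ) (A : QOp d n) : QOp d n :=
  Matrix.diagonal (fun i => A i i)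

/-- The diagonal matrix `log₂ Δ(ρ)` (entrywise base-2 logarithm of the diagonal). -/
def logDephase (d n : ℕ) (A : QOp d n) : QOp d n :=
  Matrix.diagonal (fun i => (Real.logb 2 (A i i).re : ℂ))

/-- The coherence rate `R_C(H,ρ) = -i Tr([ρ, log Δ(ρ)] H)`. -/
def cohRate (d n : ℕ) (H ρ : QOp d n) : ℂ :=
  -Complex.I * ((ρ * logDephase d n ρ - logDephase d n ρ * ρ) * H).trace

/-- The max-relative entropy `D_max(ρ‖σ) = log₂ min{λ > 0 : ρ ≤ λσ}`. -/
def Dmax (d n : ℕ) (ρ σ : QOp d n) : ℝ :=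
  Real.logb 2 (sInf {l : ℝ | 0 < l ∧ ((l : ℂ) • σ - ρ).PosSemidef})

section MagicPower

variable {d n : ℕ}

/-! ### The Pauli operators form an orthogonal basis -/

lemma shiftX_pow_apply [NeZero d] (s : ℕ) (x y : Fin d) :
    (shiftX d ^ s) x y = if (x : ℕ) = ((y : ℕ) + s) % d then 1 else 0 := by
  induction s generalizing x y with
  | zero => simp [Matrix.one_apply, Fin.ext_iff, Nat.mod_eq_of_lt y.isLt]
  | succ s ih =>
    rw [pow_succ, Matrix.mul_apply]
    simp only [ih, shiftX]
    rw [Finset.sum_eq_single (⟨((y : ℕ) + 1) % d, Nat.mod_lt _ (NeZero.pos d)⟩ : Fin d)]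
    · simp only [if_true, mul_one, Nat.mod_add_mod]
      congr 2
      ring_nf
    · intro z _ hz
      rw [if_neg (fun h => hz (Fin.ext h)), mul_zero]
    · simp

lemma pauli1_apply [NeZero d] (a : ZMod d × ZMod d) (x y : Fin d) :
    pauli1 d a x y = (if (x : ℕ) = ((y : ℕ) + a.1.val) % d then 1 else 0) *
      (Complex.exp (2 * Real.pi * Complex.I / d) ^ (y : ℕ)) ^ a.2.val := by
  rw [pauli1, clockZ, Matrix.diagonal_pow, Matrix.mul_diagonal, shiftX_pow_apply]
  congr 1
  rw [Pi.pow_apply, ← Complex.exp_nat_mul _ (y : ℕ)]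
  congr 2
  ring

lemma sum_zmod_val {M : Type*} [AddCommMonoid M] [NeZero d] (f : ℕ → M) :
    ∑ t : ZMod d, f t.val = ∑ k ∈ Finset.range d, f k := by
  obtain ⟨k, rfl⟩ := Nat.exists_eq_succ_of_ne_zero (NeZero.ne d)
  exact Fin.sum_univ_eq_sum_range f (k + 1)

lemma sum_root_pow_mul_conj [NeZero d] (y y' : Fin d) :
    ∑ t : ZMod d, (Complex.exp (2 * Real.pi * Complex.I / d) ^ (y : ℕ)) ^ t.val *
      star ((Complex.exp (2 * Real.pi * Complex.I / d) ^ (y' : ℕ)) ^ t.val) =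
      if y = y' then (d : ℂ) else 0 := by
  have hω := Complex.isPrimitiveRoot_exp d (NeZero.ne d)
  set ω := Complex.exp (2 * Real.pi * Complex.I / d) with hωdef
  have hnorm : ‖ω‖ = 1 := hω.norm'_eq_one (NeZero.ne d)
  have hstar : star ω = ω⁻¹ := (Complex.inv_eq_conj hnorm).symm
  have hω0 : ω ≠ 0 := Complex.exp_ne_zero _
  rw [sum_zmod_val (fun k => (ω ^ (y : ℕ)) ^ k * star ((ω ^ (y' : ℕ)) ^ k))]
  have hterm : ∀ k : ℕ, (ω ^ (y : ℕ)) ^ k * star ((ω ^ (y' : ℕ)) ^ k) =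
      (ω ^ (y : ℕ) * (ω ^ (y' : ℕ))⁻¹) ^ k := fun k => by
    rw [star_pow, star_pow, hstar, mul_pow, inv_pow ω]
  simp only [hterm]
  split_ifs with h
  · subst h
    simp [hω0]
  · have hne : ω ^ (y : ℕ) * (ω ^ (y' : ℕ))⁻¹ ≠ 1 := by
      intro hz
      rw [mul_inv_eq_one₀ (pow_ne_zero _ hω0)] at hz
      exact h (Fin.ext (hω.pow_inj y.isLt y'.isLt hz))
    have hone : (ω ^ (y : ℕ) * (ω ^ (y' : ℕ))⁻¹) ^ d = 1 := by
      rw [mul_pow, inv_pow, pow_right_comm, pow_right_comm ω (y' : ℕ), hω.pow_eq_one, one_pow,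
        one_pow, inv_one, one_mul]
    have := mul_neg_geom_sum (ω ^ (y : ℕ) * (ω ^ (y' : ℕ))⁻¹) d
    rw [hone, sub_self] at this
    exact (mul_eq_zero.mp this).resolve_left (sub_ne_zero.mpr hne.symm)

lemma sum_shift_indicator [NeZero d] (x x' y : Fin d) :
    ∑ s : ZMod d, (if (x : ℕ) = ((y : ℕ) + s.val) % d then (1 : ℂ) else 0) *
      (if (x' : ℕ) = ((y : ℕ) + s.val) % d then 1 else 0) = if x = x' then 1 else 0 := by
  split_ifs with h
  · subst h
    have key : ∀ s : ZMod d, (x : ℕ) = ((y : ℕ) + s.val) % d ↔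
        s = ((x : ℕ) : ZMod d) - ((y : ℕ) : ZMod d) := fun s => by
      have hcast : ((((y : ℕ) + s.val : ℕ)) : ZMod d) = s + ((y : ℕ) : ZMod d) := by
        rw [Nat.cast_add, ZMod.natCast_zmod_val, add_comm]
      rw [eq_sub_iff_add_eq, ← hcast, ZMod.natCast_eq_natCast_iff', Nat.mod_eq_of_lt x.isLt,
        eq_comm]
    simp [key]
  · refine Finset.sum_eq_zero fun s _ => ?_
    by_cases h1 : (x : ℕ) = ((y : ℕ) + s.val) % d
    · have h2 : ¬(x' : ℕ) = ((y : ℕ) + s.val) % d := fun h2 => h (Fin.ext (h1.trans h2.symm))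
      rw [if_neg h2, mul_zero]
    · rw [if_neg h1, zero_mul]

lemma sum_pauli1_mul_conj [NeZero d] (x y x' y' : Fin d) :
    ∑ a : ZMod d × ZMod d, pauli1 d a x y * star (pauli1 d a x' y') =
      if x = x' ∧ y = y' then (d : ℂ) else 0 := by
  have hfac : ∀ a : ZMod d × ZMod d, pauli1 d a x y * star (pauli1 d a x' y') =
      ((if (x : ℕ) = ((y : ℕ) + a.1.val) % d then (1 : ℂ) else 0) *
        (if (x' : ℕ) = ((y' : ℕ) + a.1.val) % d then 1 else 0)) *
      ((Complex.exp (2 * Real.pi * Complex.I / d) ^ (y : ℕ)) ^ a.2.val *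
        star ((Complex.exp (2 * Real.pi * Complex.I / d) ^ (y' : ℕ)) ^ a.2.val)) := fun a => by
    rw [pauli1_apply, pauli1_apply, star_mul', apply_ite star, star_one, star_zero]
    ring
  rw [Fintype.sum_congr _ _ hfac, Fintype.sum_prod_type]
  refine (Finset.sum_mul_sum Finset.univ Finset.univ
    (fun s : ZMod d => (if (x : ℕ) = ((y : ℕ) + s.val) % d then (1 : ℂ) else 0) *
      (if (x' : ℕ) = ((y' : ℕ) + s.val) % d then 1 else 0))
    (fun t : ZMod d => (Complex.exp (2 * Real.pi * Complex.I / d) ^ (y : ℕ)) ^ t.val *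
      star ((Complex.exp (2 * Real.pi * Complex.I / d) ^ (y' : ℕ)) ^ t.val))).symm.trans ?_
  rw [sum_root_pow_mul_conj]
  by_cases h : y = y'
  · subst h
    rw [sum_shift_indicator]
    by_cases hx : x = x' <;> simp [hx]
  · simp [h]

lemma sum_pauliN_mul_conj [NeZero d] (x y x' y' : Fin n → Fin d) :
    ∑ a : Fin n → ZMod d × ZMod d, pauliN d n a x y * star (pauliN d n a x' y') =
      if x = x' ∧ y = y' then (d : ℂ) ^ n else 0 := by
  simp only [pauliN, star_prod, ← Finset.prod_mul_distrib]
  rw [← Fintype.prod_sum fun i a => pauli1 d a (x i) (y i) * star (pauli1 d a (x' i) (y' i))]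
  simp only [sum_pauli1_mul_conj]
  split_ifs with h
  · simp [h.1, h.2]
  · obtain ⟨i, hi⟩ : ∃ i, ¬(x i = x' i ∧ y i = y' i) := by
      by_contra! hc
      exact h ⟨funext fun i => (hc i).1, funext fun i => (hc i).2⟩
    exact Finset.prod_eq_zero (Finset.mem_univ i) (if_neg hi)

/-- Parseval's identity for an operator family satisfying a completeness relation. -/
lemma sum_norm_sq_trace_mul {ι κ : Type*} [Fintype ι] [Fintype κ] [DecidableEq κ]
    (B : ι → Matrix κ κ ℂ) (c : ℂ)
    (hB : ∀ x y x' y', ∑ a, B a x y * star (B a x' y') = if x = x' ∧ y = y' then c else 0)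
    (O : Matrix κ κ ℂ) :
    ((∑ a, ‖(O * B a).trace‖ ^ 2 : ℝ) : ℂ) = c * (Oᴴ * O).trace := by
  have htr : ∀ a, (O * B a).trace = ∑ p : κ × κ, O p.1 p.2 * B a p.2 p.1 := fun a => by
    simp [Matrix.trace, Matrix.mul_apply, Fintype.sum_prod_type]
  have hsq : ∀ z : ℂ, ((‖z‖ ^ 2 : ℝ) : ℂ) = z * star z := fun z => by
    simpa using (Complex.mul_conj' z).symm
  have hterm : ∀ a, ((‖(O * B a).trace‖ ^ 2 : ℝ) : ℂ) = ∑ p : κ × κ, ∑ q : κ × κ,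
      O p.1 p.2 * star (O q.1 q.2) * (B a p.2 p.1 * star (B a q.2 q.1)) := fun a => by
    rw [hsq, htr, star_sum, Finset.sum_mul_sum]
    refine Finset.sum_congr rfl fun p _ => Finset.sum_congr rfl fun q _ => ?_
    rw [star_mul']
    ring
  rw [Complex.ofReal_sum]
  simp only [hterm]
  rw [Finset.sum_comm]
  have hq : ∀ p q : κ × κ, (p.2 = q.2 ∧ p.1 = q.1) ↔ p = q := fun p q => by
    rw [Prod.ext_iff, and_comm]
  have hin : ∀ p : κ × κ, ∑ a, ∑ q : κ × κ,
      O p.1 p.2 * star (O q.1 q.2) * (B a p.2 p.1 * star (B a q.2 q.1)) =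
      c * (star (O p.1 p.2) * O p.1 p.2) := fun p => by
    rw [Finset.sum_comm]
    simp only [← Finset.mul_sum, hB, hq]
    simp
    ring
  simp only [hin, ← Finset.mul_sum]
  congr 1
  simp only [Matrix.trace, Matrix.mul_apply, Matrix.diag_apply, Matrix.conjTranspose_apply,
    Fintype.sum_prod_type]
  exact Finset.sum_comm

lemma sum_pdist [NeZero d] (O : QOp d n) :
    ∑ a, pdist d n O a = ((Oᴴ * O).trace).re / (d : ℝ) ^ n := by
  have hd : (d : ℝ) ≠ 0 := Nat.cast_ne_zero.mpr (NeZero.ne d)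
  have h := congrArg Complex.re (sum_norm_sq_trace_mul (pauliN d n) _ sum_pauliN_mul_conj O)
  rw [Complex.ofReal_re, ← Complex.ofReal_natCast, ← Complex.ofReal_pow,
    Complex.re_ofReal_mul] at h
  simp only [pdist]
  rw [← Finset.sum_div, h, two_mul, pow_add]
  field_simp

lemma pdist_nonneg (O : QOp d n) (a : Fin n → ZMod d × ZMod d) : 0 ≤ pdist d n O a := by
  unfold pdist
  positivity

lemma l2norm_eq_sqrt_sum_pdist [NeZero d] (O : QOp d n) :
    l2norm d n O = Real.sqrt (∑ a, pdist d n O a) := by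
  rw [sum_pdist, l2norm]

lemma sum_pdist_of_l2norm_eq_one [NeZero d] {O : QOp d n} (hO : l2norm d n O = 1) :
    ∑ a, pdist d n O a = 1 := by
  rwa [l2norm_eq_sqrt_sum_pdist, Real.sqrt_eq_one] at hO

/-! ### Unitary conjugation and boundedness of the entropy -/

lemma sum_pdist_conj [NeZero d] {U : QOp d n} (hU : U ∈ Matrix.unitaryGroup (Fin n → Fin d) ℂ)
    (O : QOp d n) : ∑ a, pdist d n (U * O * Uᴴ) a = ∑ a, pdist d n O a := by
  have hU' : Uᴴ * U = 1 := Matrix.mem_unitaryGroup_iff'.mp hU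
  have h : (U * O * Uᴴ)ᴴ * (U * O * Uᴴ) = U * (Oᴴ * O * Uᴴ) := by
    simp only [Matrix.conjTranspose_mul, Matrix.conjTranspose_conjTranspose, Matrix.mul_assoc]
    rw [← Matrix.mul_assoc Uᴴ U, hU', Matrix.one_mul]
  rw [sum_pdist, sum_pdist, h, Matrix.trace_mul_comm, Matrix.mul_assoc, hU', Matrix.mul_one]

lemma l2norm_conj [NeZero d] {U : QOp d n} (hU : U ∈ Matrix.unitaryGroup (Fin n → Fin d) ℂ)
    (O : QOp d n) : l2norm d n (U * O * Uᴴ) = l2norm d n O := by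
  rw [l2norm_eq_sqrt_sum_pdist, l2norm_eq_sqrt_sum_pdist, sum_pdist_conj hU]

lemma abs_mul_logb_two_le {p : ℝ} (h0 : 0 ≤ p) (h1 : p ≤ 1) :
    |p * Real.logb 2 p| ≤ 1 / Real.log 2 := by
  have hl : 0 < Real.log 2 := Real.log_pos one_lt_two
  rcases h0.eq_or_lt with rfl | hp
  · simpa using hl.le
  · rw [Real.logb, mul_div_assoc', abs_div, abs_of_pos hl, mul_comm]
    gcongr
    exact (Real.abs_log_mul_self_lt p hp h1).le

lemma abs_qEntropy_le [NeZero d] {O : QOp d n} (hO : l2norm d n O = 1) :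
    |qEntropy d n O| ≤ ∑ _a : Fin n → ZMod d × ZMod d, 1 / Real.log 2 := by
  rw [qEntropy, abs_neg]
  refine (Finset.abs_sum_le_sum_abs _ _).trans (Finset.sum_le_sum fun a _ => ?_)
  refine abs_mul_logb_two_le (pdist_nonneg O a) ?_
  rw [← sum_pdist_of_l2norm_eq_one hO]
  exact Finset.single_le_sum (fun b _ => pdist_nonneg O b) (Finset.mem_univ a)

lemma abs_qEntropy_sub_le_magicPower [NeZero d] {U : QOp d n}
    (hU : U ∈ Matrix.unitaryGroup (Fin n → Fin d) ℂ) {O : QOp d n} (hO : l2norm d n O = 1) :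
    |qEntropy d n (U * O * Uᴴ) - qEntropy d n O| ≤ magicPower d n U := by
  refine le_csSup ⟨(∑ _a : Fin n → ZMod d × ZMod d, 1 / Real.log 2) +
    ∑ _a : Fin n → ZMod d × ZMod d, 1 / Real.log 2, ?_⟩ ⟨O, hO, rfl⟩
  rintro x ⟨O', hO', rfl⟩
  exact (abs_sub _ _).trans
    (add_le_add (abs_qEntropy_le ((l2norm_conj hU O').trans hO')) (abs_qEntropy_le hO'))

lemma magicPower_nonneg [NeZero d] (U : QOp d n) : 0 ≤ magicPower d n U := by
  refine Real.sSup_nonneg ?_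
  rintro x ⟨O, -, rfl⟩
  exact abs_nonneg _

lemma magicPower_mul_le [NeZero d] {U V : QOp d n}
    (hU : U ∈ Matrix.unitaryGroup (Fin n → Fin d) ℂ)
    (hV : V ∈ Matrix.unitaryGroup (Fin n → Fin d) ℂ) :
    magicPower d n (U * V) ≤ magicPower d n U + magicPower d n V := by
  refine Real.sSup_le ?_ (add_nonneg (magicPower_nonneg U) (magicPower_nonneg V))
  rintro x ⟨O, hO, rfl⟩
  have h : U * V * O * (U * V)ᴴ = U * (V * O * Vᴴ) * Uᴴ := by
    simp only [Matrix.conjTranspose_mul, Matrix.mul_assoc]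
  rw [h]
  exact (abs_sub_le _ (qEntropy d n (V * O * Vᴴ)) _).trans
    (add_le_add (abs_qEntropy_sub_le_magicPower hU ((l2norm_conj hV O).trans hO))
      (abs_qEntropy_sub_le_magicPower hV hO))

/-! ### Operators of arbitrary norm -/

lemma pdist_smul (r : ℝ) (O : QOp d n) (a : Fin n → ZMod d × ZMod d) :
    pdist d n ((r : ℂ) • O) a = r ^ 2 * pdist d n O a := by
  rw [pdist, pdist, Matrix.smul_mul, Matrix.trace_smul, norm_smul, mul_pow, Complex.norm_real,
    Real.norm_eq_abs, sq_abs, mul_div_assoc]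

lemma qEntropy_smul [NeZero d] {r : ℝ} (hr : r ≠ 0) {O : QOp d n}
    (hO : ∑ a, pdist d n O a = 1) :
    qEntropy d n ((r : ℂ) • O) = r ^ 2 * qEntropy d n O - r ^ 2 * Real.logb 2 (r ^ 2) := by
  have hterm : ∀ a, pdist d n ((r : ℂ) • O) a * Real.logb 2 (pdist d n ((r : ℂ) • O) a) =
      r ^ 2 * Real.logb 2 (r ^ 2) * pdist d n O a +
        r ^ 2 * (pdist d n O a * Real.logb 2 (pdist d n O a)) := fun a => by
    rw [pdist_smul]
    rcases eq_or_ne (pdist d n O a) 0 with h | h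
    · simp [h]
    · rw [Real.logb_mul (pow_ne_zero 2 hr) h]
      ring
  rw [qEntropy, qEntropy]
  simp only [hterm]
  rw [Finset.sum_add_distrib, ← Finset.mul_sum, ← Finset.mul_sum, hO]
  ring

lemma qEntropy_eq_zero_of_sum_pdist_eq_zero [NeZero d] {O : QOp d n}
    (hO : ∑ a, pdist d n O a = 0) : qEntropy d n O = 0 := by
  have h := (Finset.sum_eq_zero_iff_of_nonneg fun a _ => pdist_nonneg O a).mp hO
  simp [qEntropy, fun a => h a (Finset.mem_univ a)]

lemma abs_qEntropy_sub_le_magicPower_mul [NeZero d] {U : QOp d n}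
    (hU : U ∈ Matrix.unitaryGroup (Fin n → Fin d) ℂ) (O : QOp d n) :
    |qEntropy d n (U * O * Uᴴ) - qEntropy d n O| ≤ magicPower d n U * ∑ a, pdist d n O a := by
  rcases (Finset.sum_nonneg fun a _ => pdist_nonneg O a : 0 ≤ ∑ a, pdist d n O a).eq_or_lt
    with h | h
  · rw [qEntropy_eq_zero_of_sum_pdist_eq_zero h.symm,
      qEntropy_eq_zero_of_sum_pdist_eq_zero ((sum_pdist_conj hU O).trans h.symm), ← h]
    simp
  · set q := ∑ a, pdist d n O a with hq
    have hr : Real.sqrt q ≠ 0 := (Real.sqrt_pos.mpr h).ne'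
    set O' : QOp d n := (((Real.sqrt q)⁻¹ : ℝ) : ℂ) • O with hO'
    have hOO' : O = ((Real.sqrt q : ℝ) : ℂ) • O' := by
      rw [hO', smul_smul, ← Complex.ofReal_mul, mul_inv_cancel₀ hr, Complex.ofReal_one, one_smul]
    have hsum : ∑ a, pdist d n O' a = 1 := by
      simp only [hO', pdist_smul]
      rw [← Finset.mul_sum, ← hq, inv_pow, Real.sq_sqrt h.le, inv_mul_cancel₀ h.ne']
    have hnorm : l2norm d n O' = 1 := by rw [l2norm_eq_sqrt_sum_pdist, hsum, Real.sqrt_one]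
    have hconj : U * O * Uᴴ = ((Real.sqrt q : ℝ) : ℂ) • (U * O' * Uᴴ) := by
      rw [hOO', Matrix.mul_smul, Matrix.smul_mul]
    have hH : qEntropy d n O = _ := (congrArg _ hOO').trans (qEntropy_smul hr hsum)
    rw [hconj, qEntropy_smul hr ((sum_pdist_conj hU O').trans hsum), hH, sub_sub_sub_cancel_right, ← mul_sub, abs_mul, Real.sq_sqrt h.le,
      abs_of_pos h, mul_comm]
    gcongr
    exact abs_qEntropy_sub_le_magicPower hU hnorm

/-- If the Pauli distribution of every `m`-qudit operator `O` decomposes into those of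
`n`-qudit operators `A b O`, and conjugation by `W` acts on each `A b O` as conjugation by the
unitary `U`, then the magic power of `W` is at most that of `U`. -/
lemma magicPower_le_of_decomposition [NeZero d] {m : ℕ} {β : Type*} [Fintype β]
    {U : QOp d n} (hU : U ∈ Matrix.unitaryGroup (Fin n → Fin d) ℂ) (W : QOp d m)
    (A : β → QOp d m → QOp d n) (hA : ∀ b O, A b (W * O * Wᴴ) = U * A b O * Uᴴ)
    (e : β × (Fin n → ZMod d × ZMod d) ≃ (Fin m → ZMod d × ZMod d))
    (he : ∀ O b a, pdist d m O (e (b, a)) = pdist d n (A b O) a) :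
    magicPower d m W ≤ magicPower d n U := by
  have hsum : ∀ (f : ℝ → ℝ) (O : QOp d m),
      ∑ c, f (pdist d m O c) = ∑ b, ∑ a, f (pdist d n (A b O) a) := fun f O => by
    rw [← Equiv.sum_comp e, Fintype.sum_prod_type]
    simp only [he]
  have hH : ∀ O, qEntropy d m O = ∑ b, qEntropy d n (A b O) := fun O => by
    simp only [qEntropy]
    rw [hsum (fun p => p * Real.logb 2 p), Finset.sum_neg_distrib]
  refine Real.sSup_le ?_ (magicPower_nonneg U)
  rintro x ⟨O, hO, rfl⟩
  rw [hH, hH, ← Finset.sum_sub_distrib]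
  simp only [hA]
  calc |∑ b, (qEntropy d n (U * A b O * Uᴴ) - qEntropy d n (A b O))|
      ≤ ∑ b, |qEntropy d n (U * A b O * Uᴴ) - qEntropy d n (A b O)| :=
        Finset.abs_sum_le_sum_abs _ _
    _ ≤ ∑ b, magicPower d n U * ∑ a, pdist d n (A b O) a :=
        Finset.sum_le_sum fun b _ => abs_qEntropy_sub_le_magicPower_mul hU (A b O)
    _ = magicPower d n U := by
        rw [← Finset.mul_sum, ← hsum (fun p => p) O, sum_pdist_of_l2norm_eq_one hO, mul_one]

/-! ### Tensor products -/

variable {n₁ n₂ : ℕ}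

lemma sum_append {α M : Type*} [Fintype α] [AddCommMonoid M] (f : (Fin (n₁ + n₂) → α) → M) :
    ∑ z, f z = ∑ x : Fin n₁ → α, ∑ u : Fin n₂ → α, f (Fin.append x u) := by
  rw [← Equiv.sum_comp (Fin.appendEquiv n₁ n₂), Fintype.sum_prod_type]
  rfl

lemma tensorOp_append (A : QOp d n₁) (B : QOp d n₂) (x y : Fin n₁ → Fin d)
    (u v : Fin n₂ → Fin d) :
    tensorOp d n₁ n₂ A B (Fin.append x u) (Fin.append y v) = A x y * B u v := by
  simp [tensorOp]

lemma qOp_ext_append {A B : QOp d (n₁ + n₂)}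
    (h : ∀ (x y : Fin n₁ → Fin d) (u v : Fin n₂ → Fin d),
      A (Fin.append x u) (Fin.append y v) = B (Fin.append x u) (Fin.append y v)) : A = B := by
  ext z w
  obtain ⟨⟨x, u⟩, rfl⟩ := (Fin.appendEquiv n₁ n₂).surjective z
  obtain ⟨⟨y, v⟩, rfl⟩ := (Fin.appendEquiv n₁ n₂).surjective w
  exact h x y u v

lemma tensorOp_mul (A C : QOp d n₁) (B D : QOp d n₂) :
    tensorOp d n₁ n₂ A B * tensorOp d n₁ n₂ C D = tensorOp d n₁ n₂ (A * C) (B * D) := by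
  refine qOp_ext_append fun x y u v => ?_
  rw [Matrix.mul_apply, sum_append, tensorOp_append, Matrix.mul_apply, Matrix.mul_apply,
    Finset.sum_mul_sum]
  simp only [tensorOp_append]
  refine Finset.sum_congr rfl fun _ _ => Finset.sum_congr rfl fun _ _ => ?_
  ring

lemma tensorOp_conjTranspose (A : QOp d n₁) (B : QOp d n₂) :
    (tensorOp d n₁ n₂ A B)ᴴ = tensorOp d n₁ n₂ Aᴴ Bᴴ := by
  ext x y
  simp [tensorOp, Matrix.conjTranspose_apply]

lemma tensorOp_one_one : tensorOp d n₁ n₂ 1 1 = 1 := by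
  refine qOp_ext_append fun x y u v => ?_
  rw [tensorOp_append]
  have h : Fin.append x u = Fin.append y v ↔ x = y ∧ u = v := by
    rw [← Prod.mk_inj]
    exact (Fin.appendEquiv n₁ n₂).injective.eq_iff (a := (x, u)) (b := (y, v))
  simp only [Matrix.one_apply, h]
  by_cases hx : x = y <;> simp [hx]

lemma tensorOp_mem_unitaryGroup {U : QOp d n₁} {V : QOp d n₂}
    (hU : U ∈ Matrix.unitaryGroup (Fin n₁ → Fin d) ℂ)
    (hV : V ∈ Matrix.unitaryGroup (Fin n₂ → Fin d) ℂ) :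
    tensorOp d n₁ n₂ U V ∈ Matrix.unitaryGroup (Fin (n₁ + n₂) → Fin d) ℂ := by
  rw [Matrix.mem_unitaryGroup_iff, Matrix.star_eq_conjTranspose] at *
  rw [tensorOp_conjTranspose, tensorOp_mul, hU, hV, tensorOp_one_one]

lemma pauliN_append (a : Fin n₁ → ZMod d × ZMod d) (b : Fin n₂ → ZMod d × ZMod d) :
    pauliN d (n₁ + n₂) (Fin.append a b) = tensorOp d n₁ n₂ (pauliN d n₁ a) (pauliN d n₂ b) := by
  ext x y
  simp [pauliN, tensorOp, Fin.prod_univ_add]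

/-- The partial trace `Tr₂(O (I ⊗ B))`. -/
def partialTraceRight (d n₁ n₂ : ℕ) (B : QOp d n₂) (O : QOp d (n₁ + n₂)) : QOp d n₁ :=
  fun x y => ∑ u, ∑ v, O (Fin.append x u) (Fin.append y v) * B v u

/-- The partial trace `Tr₁(O (B ⊗ I))`. -/
def partialTraceLeft (d n₁ n₂ : ℕ) (B : QOp d n₁) (O : QOp d (n₁ + n₂)) : QOp d n₂ :=
  fun u v => ∑ x, ∑ y, O (Fin.append x u) (Fin.append y v) * B y x

lemma trace_partialTraceRight_mul (A : QOp d n₁) (B : QOp d n₂) (O : QOp d (n₁ + n₂)) :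
    (partialTraceRight d n₁ n₂ B O * A).trace = (O * tensorOp d n₁ n₂ A B).trace := by
  simp only [Matrix.trace, Matrix.diag_apply, Matrix.mul_apply, sum_append, tensorOp_append,
    partialTraceRight, Finset.sum_mul]
  refine Finset.sum_congr rfl fun x _ => ?_
  rw [Finset.sum_comm]
  refine Finset.sum_congr rfl fun u _ => Finset.sum_congr rfl fun y _ =>
    Finset.sum_congr rfl fun v _ => ?_
  ring

lemma trace_partialTraceLeft_mul (A : QOp d n₁) (B : QOp d n₂) (O : QOp d (n₁ + n₂)) :
    (partialTraceLeft d n₁ n₂ A O * B).trace = (O * tensorOp d n₁ n₂ A B).trace := by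
  simp only [Matrix.trace, Matrix.diag_apply, Matrix.mul_apply, sum_append, tensorOp_append,
    partialTraceLeft, Finset.sum_mul]
  rw [Finset.sum_comm (s := (Finset.univ : Finset (Fin n₁ → Fin d)))]
  refine Finset.sum_congr rfl fun u _ => ?_
  rw [Finset.sum_comm]
  refine Finset.sum_congr rfl fun x _ => ?_
  rw [Finset.sum_comm]
  refine Finset.sum_congr rfl fun y _ => Finset.sum_congr rfl fun v _ => ?_
  ring

lemma partialTraceRight_conj (U : QOp d n₁) (B : QOp d n₂) (O : QOp d (n₁ + n₂)) :
    partialTraceRight d n₁ n₂ B (tensorOp d n₁ n₂ U 1 * O * (tensorOp d n₁ n₂ U 1)ᴴ) =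
      U * partialTraceRight d n₁ n₂ B O * Uᴴ := by
  refine Matrix.ext_iff_trace_mul_right.mpr fun C => ?_
  rw [trace_partialTraceRight_mul, tensorOp_conjTranspose, Matrix.mul_assoc, Matrix.mul_assoc,
    Matrix.trace_mul_comm, Matrix.mul_assoc, Matrix.mul_assoc, tensorOp_mul, tensorOp_mul,
    ← trace_partialTraceRight_mul, Matrix.mul_assoc, Matrix.mul_assoc, Matrix.trace_mul_comm U]
  simp [Matrix.mul_assoc]

lemma partialTraceLeft_conj (V : QOp d n₂) (B : QOp d n₁) (O : QOp d (n₁ + n₂)) :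
    partialTraceLeft d n₁ n₂ B (tensorOp d n₁ n₂ 1 V * O * (tensorOp d n₁ n₂ 1 V)ᴴ) =
      V * partialTraceLeft d n₁ n₂ B O * Vᴴ := by
  refine Matrix.ext_iff_trace_mul_right.mpr fun C => ?_
  rw [trace_partialTraceLeft_mul, tensorOp_conjTranspose, Matrix.mul_assoc, Matrix.mul_assoc,
    Matrix.trace_mul_comm, Matrix.mul_assoc, Matrix.mul_assoc, tensorOp_mul, tensorOp_mul,
    ← trace_partialTraceLeft_mul, Matrix.mul_assoc, Matrix.mul_assoc, Matrix.trace_mul_comm V]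
  simp [Matrix.mul_assoc]

lemma magicPower_tensorOp_one_le [NeZero d] {U : QOp d n₁}
    (hU : U ∈ Matrix.unitaryGroup (Fin n₁ → Fin d) ℂ) :
    magicPower d (n₁ + n₂) (tensorOp d n₁ n₂ U 1) ≤ magicPower d n₁ U := by
  have hd : (d : ℝ) ≠ 0 := Nat.cast_ne_zero.mpr (NeZero.ne d)
  refine magicPower_le_of_decomposition hU _
    (fun b O => (((d : ℝ) ^ n₂)⁻¹ : ℝ) • partialTraceRight d n₁ n₂ (pauliN d n₂ b) O)
    (fun b O => ?_) ((Equiv.prodComm _ _).trans (Fin.appendEquiv n₁ n₂)) (fun O b a => ?_)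
  · rw [partialTraceRight_conj, Matrix.mul_smul, Matrix.smul_mul]
  · change pdist d (n₁ + n₂) O (Fin.append a b) = pdist d n₁ ((((d : ℝ) ^ n₂)⁻¹ : ℝ) • _) a
    rw [← Complex.coe_smul, pdist_smul, pdist, pdist, pauliN_append, trace_partialTraceRight_mul]
    field_simp
    ring

lemma magicPower_one_tensorOp_le [NeZero d] {V : QOp d n₂}
    (hV : V ∈ Matrix.unitaryGroup (Fin n₂ → Fin d) ℂ) :
    magicPower d (n₁ + n₂) (tensorOp d n₁ n₂ 1 V) ≤ magicPower d n₂ V := by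
  have hd : (d : ℝ) ≠ 0 := Nat.cast_ne_zero.mpr (NeZero.ne d)
  refine magicPower_le_of_decomposition hV _
    (fun a O => (((d : ℝ) ^ n₁)⁻¹ : ℝ) • partialTraceLeft d n₁ n₂ (pauliN d n₁ a) O)
    (fun a O => ?_) (Fin.appendEquiv n₁ n₂) (fun O a b => ?_)
  · rw [partialTraceLeft_conj, Matrix.mul_smul, Matrix.smul_mul]
  · change pdist d (n₁ + n₂) O (Fin.append a b) = pdist d n₂ ((((d : ℝ) ^ n₁)⁻¹ : ℝ) • _) b
    rw [← Complex.coe_smul, pdist_smul, pdist, pdist, pauliN_append, trace_partialTraceLeft_mul]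
    field_simp
    ring

end MagicPower

/-- Magic power is subadditive under multiplication and under tensorization. -/
theorem magicPower_subadditive (d : ℕ) (hd : 2 ≤ d) [NeZero d] :
    (∀ (n : ℕ) (U V : QOp d n),
      U ∈ Matrix.unitaryGroup (Fin n → Fin d) ℂ →
      V ∈ Matrix.unitaryGroup (Fin n → Fin d) ℂ →
      magicPower d n (U * V) ≤ magicPower d n U + magicPower d n V) ∧
    (∀ (n₁ n₂ : ℕ) (U : QOp d n₁) (V : QOp d n₂),
      U ∈ Matrix.unitaryGroup (Fin n₁ → Fin d) ℂ →
      V ∈ Matrix.unitaryGroup (Fin n₂ → Fin d) ℂ →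
      magicPower d (n₁ + n₂) (tensorOp d n₁ n₂ U V)
        ≤ magicPower d n₁ U + magicPower d n₂ V) := by
  refine ⟨fun n U V hU hV => magicPower_mul_le hU hV, fun n₁ n₂ U V hU hV => ?_⟩
  have hfac : tensorOp d n₁ n₂ U V = tensorOp d n₁ n₂ U 1 * tensorOp d n₁ n₂ 1 V := by
    rw [tensorOp_mul, Matrix.mul_one, Matrix.one_mul]
  rw [hfac]
  exact (magicPower_mul_le (tensorOp_mem_unitaryGroup hU (one_mem _))
    (tensorOp_mem_unitaryGroup (one_mem _) hV)).trans
    (add_le_add (magicPower_tensorOp_one_le hU) (magicPower_one_tensorOp_le hV))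

end QC
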